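/- Let k be an algebraically closed field, let n ≥ 3 be an integer, and let f be a homogeneous polynomial of degree 3 in n+1 variables over k defining a smooth cubic hypersurface X ⊂ Pⁿ_k. Then X contains a line: there exist two linearly independent vectors v, w ∈ k^{n+1} such that f(s·v + t·w) = 0 for all s, t ∈ k. (This is the nonemptiness of the Fano variety of lines of X.) -/

import Mathlib

/-- A map on tuples of power series that preserves `X`-adic congruences becomes a contraction
after multiplication by `X`, hence has a fixed point. -/
theorem PowerSeries.exists_eq_X_mul {k ι : Type*} [CommRing k]
    (Φ : (ι → PowerSeries k) → ι → PowerSeries k)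
    (hΦ : ∀ (m : ℕ) (y z : ι → PowerSeries k),
      (∀ i, PowerSeries.X ^ m ∣ y i - z i) → ∀ i, PowerSeries.X ^ m ∣ Φ y i - Φ z i) :
    ∃ y : ι → PowerSeries k, ∀ i, y i = PowerSeries.X * Φ y i := by
  let u : ℕ → ι → PowerSeries k := fun n => Nat.rec 0 (fun _ y i => PowerSeries.X * Φ y i) n
  have hu (n : ℕ) (i : ι) : u (n + 1) i = PowerSeries.X * Φ (u n) i := rfl
  have hstep (n : ℕ) : ∀ i, PowerSeries.X ^ n ∣ u (n + 1) i - u n i := by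
    induction n with
    | zero => simp
    | succ n ih =>
      intro i
      rw [hu (n + 1), hu n, ← mul_sub, pow_succ']
      exact mul_dvd_mul_left _ (hΦ n _ _ ih i)
  have hle (n m : ℕ) (i : ι) : PowerSeries.X ^ n ∣ u (n + m) i - u n i := by
    induction m with
    | zero => simp
    | succ m ih =>
      rw [← sub_add_sub_cancel _ (u (n + m) i)]
      exact dvd_add ((pow_dvd_pow _ (Nat.le_add_right n m)).trans (hstep _ i)) ih
  let y : ι → PowerSeries k := fun i => PowerSeries.mk fun n => PowerSeries.coeff n (u (n + 1) i)
  have hy (n : ℕ) (i : ι) : PowerSeries.X ^ n ∣ y i - u n i := by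
    rw [PowerSeries.X_pow_dvd_iff]
    intro m hm
    have h := PowerSeries.X_pow_dvd_iff.mp (hle (m + 1) (n - (m + 1)) i) m (Nat.lt_succ_self m)
    rw [Nat.add_sub_cancel' hm, map_sub, sub_eq_zero] at h
    simp [y, h]
  refine ⟨y, fun i => sub_eq_zero.mp ?_⟩
  ext n
  have h : PowerSeries.X ^ (n + 1) ∣ y i - PowerSeries.X * Φ y i := by
    rw [← sub_sub_sub_cancel_right _ _ (u (n + 1) i)]
    refine dvd_sub (hy _ i) ?_
    rw [hu, ← mul_sub, pow_succ']
    exact mul_dvd_mul_left _ (hΦ n _ _ (hy n) i)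
  simpa using PowerSeries.X_pow_dvd_iff.mp h n (Nat.lt_succ_self n)

theorem MvPolynomial.dvd_aeval_sub_aeval {σ R S : Type*} [CommRing R] [CommRing S] [Algebra R S]
    (p : MvPolynomial σ R) {d : S} {x y : σ → S} (h : ∀ i, d ∣ x i - y i) :
    d ∣ aeval x p - aeval y p := by
  induction p using MvPolynomial.induction_on with
  | C a => simp
  | add p q hp hq =>
    rw [map_add, map_add, add_sub_add_comm]
    exact dvd_add hp hq
  | mul_X p i hp =>
    rw [map_mul, map_mul, aeval_X, aeval_X]
    exact dvd_mul_sub_mul hp (h i)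

theorem MvPolynomial.aeval_smul_of_isHomogeneous {σ R S : Type*} [CommRing R] [CommRing S]
    [Algebra R S] {p : MvPolynomial σ R} {d : ℕ} (hp : p.IsHomogeneous d) (c : S) (x : σ → S) :
    aeval (c • x) p = c ^ d * aeval x p := by
  simp only [aeval_def, eval₂_eq, Finset.mul_sum]
  refine Finset.sum_congr rfl fun m hm => ?_
  have h := hp (mem_support_iff.mp hm)
  rw [Finsupp.weight_apply] at h
  simp only [Pi.smul_apply, smul_eq_mul, mul_pow, Finset.prod_mul_distrib, Finset.prod_pow_eq_pow_sum]
  have : ∑ i ∈ m.support, m i = d := by simpa [Finsupp.sum] using h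
  rw [this]; ring

/-- If a homogeneous polynomial vanishes on an affine line not through the origin, it vanishes
on the plane spanned by that line. -/
theorem MvPolynomial.eval_eq_zero_of_aeval_affine_eq_zero {σ K : Type*} [Field K]
    [Infinite K] {p : MvPolynomial σ K} {d : ℕ} (hp : p.IsHomogeneous d) {v w : σ → K}
    (h : aeval (fun j => Polynomial.C (v j) + Polynomial.X * Polynomial.C (w j)) p = 0) (x y : K) :
    eval (x • v + y • w) p = 0 := by
  have hne (x : K) (hx : x ≠ 0) : eval (x • v + y • w) p = 0 := by
    have h1 : eval (v + (y / x) • w) p = 0 := by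
      have := congrArg (Polynomial.aeval (y / x)) h
      rw [MvPolynomial.comp_aeval_apply, map_zero] at this
      rw [← this, ← MvPolynomial.aeval_eq_eval]
      congr 2
      ext j
      simp [mul_comm (y / x)]
    have h2 : x • v + y • w = x • (v + (y / x) • w) := by
      rw [smul_add, smul_smul, mul_div_cancel₀ _ hx]
    have := aeval_smul_of_isHomogeneous hp x (v + (y / x) • w)
    simp only [MvPolynomial.aeval_eq_eval] at this
    rw [h2, this, h1, mul_zero]
  let q : Polynomial K :=
    aeval (fun j => Polynomial.X * Polynomial.C (v j) + Polynomial.C (y * w j)) p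
  have hq (x : K) : q.eval x = eval (x • v + y • w) p := by
    rw [← Polynomial.coe_aeval_eq_eval, ← MvPolynomial.aeval_eq_eval]
    rw [MvPolynomial.comp_aeval_apply]
    congr 2
    ext j
    simp [mul_comm x]
  have hz : Polynomial.X * q = 0 := by
    apply Polynomial.funext
    intro x
    by_cases hx : x = 0
    · simp [hx]
    · simp [hq, hne x hx]
  rw [← hq, (mul_eq_zero.mp hz).resolve_left Polynomial.X_ne_zero, Polynomial.eval_zero]

/-- A point of projective space over an extension field of `k`, and a transcendental `s`, can be
specialised to `k`-rational ones, with `s` going to any prescribed value. -/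
theorem exists_algHom_adjoin_div {k K ι : Type*} [Field k] [IsAlgClosed k] [Field K] [Algebra k K]
    [Finite ι] {s : K} (hs : Transcendental k s) (c : k) {p : ι → K} (hp : p ≠ 0) :
    ∃ i, p i ≠ 0 ∧ ∃ A : Subalgebra k K, ∃ hsA : s ∈ A, (∀ j, p j / p i ∈ A) ∧
      ∃ φ : A →ₐ[k] k, φ ⟨s, hsA⟩ = c := by
  let B : Subalgebra k K := Algebra.adjoin k {s}
  have hsB : s - algebraMap k K c ∈ B :=
    sub_mem (Algebra.self_mem_adjoin_singleton k s) (B.algebraMap_mem c)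
  let b : B.toSubring := ⟨s - algebraMap k K c, hsB⟩
  have hI : Ideal.span {b} ≠ ⊤ := by
    rw [Ne, Ideal.span_singleton_eq_top]
    rintro hu
    obtain ⟨⟨g, hg⟩, hbg⟩ := hu.exists_right_inv
    obtain ⟨q, rfl⟩ : ∃ q : Polynomial k, Polynomial.aeval s q = g := by
      have : g ∈ Algebra.adjoin k {s} := hg
      rwa [Algebra.adjoin_singleton_eq_range_aeval] at this
    have h1 : (s - algebraMap k K c) * Polynomial.aeval s q = 1 := congrArg Subtype.val hbg
    have h2 : (Polynomial.X - Polynomial.C c) * q = 1 := by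
      apply transcendental_iff_injective.mp hs
      simpa using h1
    simpa using congrArg (Polynomial.eval c) h2
  obtain ⟨V, hBV, hV⟩ := Ideal.image_subset_nonunits_valuationSubring _ hI
  have hbV : s - algebraMap k K c ∈ V.nonunits :=
    hV ⟨b, Ideal.subset_span rfl, rfl⟩
  obtain ⟨j₀, hj₀⟩ := Function.ne_iff.mp hp
  have : Nonempty ι := ⟨j₀⟩
  obtain ⟨i, hi⟩ := Finite.exists_max fun j => V.valuation (p j)
  have hpi : p i ≠ 0 := by
    intro h0
    have := hi j₀
    simp only [h0, map_zero, le_zero_iff, map_eq_zero] at this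
    exact hj₀ this
  have hle (j : ι) : p j / p i ∈ V := by
    rw [← V.valuation_le_one_iff, map_div₀]
    exact div_le_one_of_le₀ (hi j) zero_le
  let A : Subalgebra k K := Algebra.adjoin k (insert s (Set.range fun j => p j / p i))
  have hsA : s ∈ A := Algebra.subset_adjoin (Set.mem_insert _ _)
  have hkV (a : k) : algebraMap k K a ∈ V := hBV (B.algebraMap_mem a)
  have hAV : ∀ x ∈ A, x ∈ V := by
    intro x hx
    induction hx using Algebra.adjoin_induction with
    | mem x hx =>
      rcases hx with rfl | ⟨j, rfl⟩
      · exact hBV (Algebra.self_mem_adjoin_singleton k x)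
      · exact hle j
    | algebraMap a => exact hkV a
    | add x y _ _ hx hy => exact add_mem hx hy
    | mul x y _ _ hx hy => exact mul_mem hx hy
  refine ⟨i, hpi, A, hsA, fun j => Algebra.subset_adjoin (Set.mem_insert_of_mem _ ⟨j, rfl⟩), ?_⟩
  let a : A := ⟨s, hsA⟩ - algebraMap k A c
  have ha : ¬ IsUnit a := by
    intro hu
    obtain ⟨⟨g, hg⟩, hag⟩ := hu.exists_right_inv
    have h1 : (s - algebraMap k K c) * g = 1 := congrArg Subtype.val hag
    rw [V.mem_nonunits_iff_or, sub_eq_zero] at hbV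
    rcases hbV with hb | hb
    · simp [hb] at h1
    · exact hb (eq_inv_of_mul_eq_one_right h1 ▸ hAV g hg)
  obtain ⟨M, hM, haM⟩ := exists_max_ideal_of_mem_nonunits ha
  have : Algebra.FiniteType k A := .adjoin_of_finite ((Set.finite_range _).insert s)
  let _ : Field (A ⧸ M) := Ideal.Quotient.field M
  have : Module.Finite k (A ⧸ M) := finite_of_finite_type_of_isJacobsonRing k (A ⧸ M)
  let e : k ≃ₐ[k] A ⧸ M := AlgEquiv.ofBijective (Algebra.ofId k (A ⧸ M))
    IsAlgClosed.algebraMap_bijective_of_isIntegral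
  refine ⟨e.symm.toAlgHom.comp (Ideal.Quotient.mkₐ k M), ?_⟩
  have h0 : (Ideal.Quotient.mkₐ k M) ⟨s, hsA⟩ = algebraMap k (A ⧸ M) c := by
    have := Ideal.Quotient.eq_zero_iff_mem.mpr haM
    rw [map_sub, sub_eq_zero] at this
    exact this
  rw [AlgHom.comp_apply, h0]
  exact e.symm.commutes c

open Polynomial in
/-- The line `x₂ = x₃ = 0` on the cubic surface `x₂ x₀² + x₃ x₁² = 0` deforms, over `k⟦X⟧`,
along with the perturbation of the equation by `X` times any other cubic. -/
theorem exists_powerSeries_line {k : Type*} [CommRing k] [Nontrivial k]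
    (h : MvPolynomial (Fin 4) k) (hh : h.totalDegree ≤ 3) :
    ∃ v w : Fin 4 → PowerSeries k, v 0 = 1 ∧ v 1 = 0 ∧ w 0 = 0 ∧ w 1 = 1 ∧
      MvPolynomial.aeval (fun j => C (v j) + X * C (w j))
          (MvPolynomial.X 2 * MvPolynomial.X 0 ^ 2 + MvPolynomial.X 3 * MvPolynomial.X 1 ^ 2 :
            MvPolynomial (Fin 4) k) +
        C PowerSeries.X * MvPolynomial.aeval (fun j => C (v j) + X * C (w j)) h = 0 := by
  let L : (Fin 4 → PowerSeries k) → Fin 4 → (PowerSeries k)[X] :=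
    fun y j => C (![1, 0, y 0, y 2] j) + X * C (![0, 1, y 1, y 3] j)
  let H : (Fin 4 → PowerSeries k) → (PowerSeries k)[X] := fun y => MvPolynomial.aeval (L y) h
  obtain ⟨y, hy⟩ := PowerSeries.exists_eq_X_mul
    (fun (y : Fin 4 → PowerSeries k) (i : Fin 4) => -(H y).coeff i) (by
      intro m y z hyz i
      have hL (j : Fin 4) : C (PowerSeries.X ^ m) ∣ L y j - L z j := by
        have : L y j - L z j = C (![1, 0, y 0, y 2] j - ![1, 0, z 0, z 2] j) +
            X * C (![0, 1, y 1, y 3] j - ![0, 1, z 1, z 3] j) := by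
          simp only [L, C_sub]; ring
        rw [this]
        refine dvd_add (C.map_dvd ?_) (dvd_mul_of_dvd_right (C.map_dvd ?_) _) <;>
          fin_cases j <;> simp [hyz]
      have := (C_dvd_iff_dvd_coeff _ _).mp (MvPolynomial.dvd_aeval_sub_aeval h hL) i
      rw [coeff_sub] at this
      rw [neg_sub_neg, ← neg_sub, dvd_neg]
      exact this)
  refine ⟨![1, 0, y 0, y 2], ![0, 1, y 1, y 3], rfl, rfl, rfl, rfl, ?_⟩
  have hdeg : (H y).natDegree < 4 := by
    have hL (j : Fin 4) : (L y j).natDegree ≤ 1 := by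
      refine natDegree_add_le_of_degree_le (by simp) ?_
      exact (natDegree_mul_C_le X _).trans natDegree_X_le
    have hmap : (MvPolynomial.map (algebraMap k (PowerSeries k)) h).totalDegree ≤ 3 :=
      (Finset.sup_mono (MvPolynomial.support_map_subset _ h)).trans hh
    have := MvPolynomial.aeval_natDegree_le _ hmap (L y) hL
    rw [MvPolynomial.aeval_map_algebraMap] at this
    exact Nat.lt_succ_of_le this
  have hsum := (H y).as_sum_range_C_mul_X_pow' hdeg
  have h0 := hy 0
  have h1 := hy 1
  have h2 := hy 2
  have h3 := hy 3
  change MvPolynomial.aeval (L y) _ + C PowerSeries.X * H y = 0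
  simp only [Fin.isValue, Fin.val_zero, Fin.val_one, Fin.val_two] at h0 h1 h2 h3
  have hv3 : ((3 : Fin 4) : ℕ) = 3 := rfl
  rw [hv3] at h3
  have e : MvPolynomial.aeval (L y) (MvPolynomial.X 2 * MvPolynomial.X 0 ^ 2 +
      MvPolynomial.X 3 * MvPolynomial.X 1 ^ 2 : MvPolynomial (Fin 4) k) =
      C (y 0) + C (y 1) * X + (C (y 2) + C (y 3) * X) * X ^ 2 := by
    simp [L]
  rw [e, hsum, h0, h1, h2, h3]
  simp only [Finset.sum_range_succ, Finset.sum_range_zero, C_mul, C_neg]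
  ring

/-- Every cubic surface over an algebraically closed field contains a line. -/
theorem exists_line_of_isHomogeneous_three {k : Type*} [Field k] [IsAlgClosed k]
    (f : MvPolynomial (Fin 4) k) (hf : f.IsHomogeneous 3) :
    ∃ v w : Fin 4 → k, LinearIndependent k ![v, w] ∧
      ∀ x y : k, MvPolynomial.eval (x • v + y • w) f = 0 := by
  let f₀ : MvPolynomial (Fin 4) k :=
    MvPolynomial.X 2 * MvPolynomial.X 0 ^ 2 + MvPolynomial.X 3 * MvPolynomial.X 1 ^ 2
  have hf₀ : f₀.IsHomogeneous 3 := by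
    have hX (i j : Fin 4) :
        (MvPolynomial.X i * MvPolynomial.X j ^ 2 : MvPolynomial (Fin 4) k).IsHomogeneous 3 :=
      (MvPolynomial.isHomogeneous_X k i).mul ((MvPolynomial.isHomogeneous_X k j).pow 2)
    exact (hX _ _).add (hX _ _)
  have hh : (f - f₀).IsHomogeneous 3 := hf.sub hf₀
  obtain ⟨v, w, hv0, hv1, hw0, hw1, hvw⟩ := exists_powerSeries_line (f - f₀) hh.totalDegree_le
  change MvPolynomial.aeval _ f₀ + _ = 0 at hvw
  clear_value f₀
  let K := FractionRing (PowerSeries k)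
  let ι : PowerSeries k →ₐ[k] K := IsScalarTower.toAlgHom k (PowerSeries k) K
  have hι : Function.Injective ι := IsFractionRing.injective (PowerSeries k) K
  let s : K := ι PowerSeries.X
  have hs : Transcendental k s := by
    rw [transcendental_iff_injective]
    have : (Polynomial.aeval s : Polynomial k →ₐ[k] K) =
        ι.comp (Polynomial.coeToPowerSeries.algHom k) := by
      ext; simp [s, Polynomial.coeToPowerSeries.algHom_apply]
    rw [this]
    refine hι.comp fun a b hab => Polynomial.coe_injective k ?_
    simpa [Polynomial.coeToPowerSeries.algHom_apply] using hab
  let g : MvPolynomial (Fin 4) K := MvPolynomial.map (algebraMap k K) f₀ +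
    MvPolynomial.C s * MvPolynomial.map (algebraMap k K) (f - f₀)
  have hg : g.IsHomogeneous 3 := by
    refine (hf₀.map _).add ?_
    simpa using (MvPolynomial.isHomogeneous_C (Fin 4) s).mul (hh.map (algebraMap k K))
  have hK : Infinite K := Infinite.of_injective _ (algebraMap k K).injective
  have hgeval (z : Fin 4 → K) : MvPolynomial.eval z g =
      MvPolynomial.aeval z f₀ + s * MvPolynomial.aeval z (f - f₀) := by
    simp only [g, map_add, map_mul, MvPolynomial.eval_C, MvPolynomial.eval_map,
      MvPolynomial.aeval_def]
  have hline (x y : K) : MvPolynomial.eval (x • (ι ∘ v) + y • (ι ∘ w)) g = 0 := by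
    refine MvPolynomial.eval_eq_zero_of_aeval_affine_eq_zero hg ?_ x y
    have := congrArg (Polynomial.mapAlgHom ι) hvw
    rw [map_add, map_mul, MvPolynomial.comp_aeval_apply, MvPolynomial.comp_aeval_apply,
      map_zero] at this
    simp only [g, map_add, map_mul, MvPolynomial.aeval_map_algebraMap]
    simpa [s] using this
  let p : Fin 4 × Fin 4 → K := fun q => ι (v q.1) * ι (w q.2) - ι (v q.2) * ι (w q.1)
  have hp : p ≠ 0 := Function.ne_iff.mpr ⟨(0, 1), by simp [p, hv0, hv1, hw0, hw1]⟩
  obtain ⟨⟨a, b⟩, hab, A, hsA, hpA, φ, hφ⟩ := exists_algHom_adjoin_div hs 1 hp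
  let v' : Fin 4 → A := fun l => ⟨_, hpA (l, b)⟩
  let w' : Fin 4 → A := fun l => ⟨_, hpA (a, l)⟩
  have hva : φ (v' a) = 1 := by
    rw [← map_one φ]; exact congrArg φ (Subtype.ext (div_self hab))
  have hwb : φ (w' b) = 1 := by
    rw [← map_one φ]; exact congrArg φ (Subtype.ext (div_self hab))
  have hvb : φ (v' b) = 0 := by
    rw [← map_zero φ]; exact congrArg φ (Subtype.ext (by simp [v', p]))
  have hwa : φ (w' a) = 0 := by
    rw [← map_zero φ]; exact congrArg φ (Subtype.ext (by simp [w', p]))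
  refine ⟨φ ∘ v', φ ∘ w', ?_, fun x y => ?_⟩
  · rw [LinearIndependent.pair_iff]
    intro x y hxy
    have h1 := congrFun hxy a
    have h2 := congrFun hxy b
    simp only [Pi.add_apply, Pi.smul_apply, Function.comp_apply, hva, hwa, hvb, hwb] at h1 h2
    exact ⟨by simpa using h1, by simpa using h2⟩
  · let z : Fin 4 → A := x • v' + y • w'
    have hz : MvPolynomial.aeval z f₀ + ⟨s, hsA⟩ * MvPolynomial.aeval z (f - f₀) = 0 := by
      suffices A.val (MvPolynomial.aeval z f₀ + ⟨s, hsA⟩ * MvPolynomial.aeval z (f - f₀)) =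
        A.val 0 from Subtype.val_injective this
      rw [map_add, map_mul, MvPolynomial.comp_aeval_apply, MvPolynomial.comp_aeval_apply, map_zero]
      change _ + s * _ = _
      rw [← hgeval]
      convert hline ((algebraMap k K x * ι (w b) - algebraMap k K y * ι (w a)) / p (a, b))
        ((algebraMap k K y * ι (v a) - algebraMap k K x * ι (v b)) / p (a, b)) using 3
      ext l
      simp [z, v', w', p, Algebra.smul_def]
      ring
    have := congrArg φ hz
    rw [map_add, map_mul, MvPolynomial.comp_aeval_apply, MvPolynomial.comp_aeval_apply, map_zero,
      hφ, one_mul, ← map_add, add_sub_cancel, MvPolynomial.aeval_eq_eval] at this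
    rw [← this]
    congr 2
    ext l
    simp [z]



/-- Let `k` be an algebraically closed field, `n ≥ 3`, and `f` a homogeneous polynomial
of degree 3 in `n+1` variables over `k` defining a smooth cubic hypersurface
`X ⊂ Pⁿ_k`. Then `X` contains a line (nonemptiness of the Fano variety of lines). -/
theorem smooth_cubic_hypersurface_contains_line
    (k : Type) [Field k] [IsAlgClosed k] (n : ℕ) (hn : 3 ≤ n)
    (f : MvPolynomial (Fin (n + 1)) k) (hf : f.IsHomogeneous 3)
    (hsmooth : ¬ ∃ x : Fin (n + 1) → k, x ≠ 0 ∧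
      MvPolynomial.eval x f = 0 ∧
      ∀ i, MvPolynomial.eval x (MvPolynomial.pderiv i f) = 0) :
    ∃ v w : Fin (n + 1) → k, LinearIndependent k ![v, w] ∧
      ∀ s t : k, MvPolynomial.eval (fun i => s * v i + t * w i) f = 0 := by
  let r : Fin (n + 1) → MvPolynomial (Fin 4) k :=
    fun j => if h : (j : ℕ) < 4 then MvPolynomial.X ⟨j, h⟩ else 0
  have hr (j : Fin (n + 1)) : (r j).IsHomogeneous 1 := by
    by_cases h : (j : ℕ) < 4
    · simpa [r, h] using MvPolynomial.isHomogeneous_X k _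
    · simpa [r, h] using MvPolynomial.isHomogeneous_zero _ _ _
  obtain ⟨v, w, hvw, hline⟩ :=
    exists_line_of_isHomogeneous_three (MvPolynomial.aeval r f) (by simpa using hf.aeval r hr)
  let E : (Fin 4 → k) →ₗ[k] Fin (n + 1) → k :=
    LinearMap.pi fun j => if h : (j : ℕ) < 4 then LinearMap.proj ⟨j, h⟩ else 0
  have hE : Function.Injective E := by
    intro x y hxy
    ext i
    have := congrFun hxy (Fin.castLE (by omega) i)
    simpa [E] using this
  refine ⟨E v, E w, ?_, fun s t => ?_⟩
  · have := hvw.map' E (LinearMap.ker_eq_bot.mpr hE)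
    have hcomp : ![E v, E w] = E ∘ ![v, w] := by
      ext i
      fin_cases i <;> rfl
    rw [hcomp]
    exact this
  · rw [← hline s t, ← MvPolynomial.aeval_eq_eval, ← MvPolynomial.aeval_eq_eval]
    have := MvPolynomial.comp_aeval_apply r (MvPolynomial.aeval (s • v + t • w)) f
    refine Eq.trans ?_ this.symm
    congr 2
    ext j
    by_cases h : (j : ℕ) < 4 <;> simp [E, r, h]
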